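/- Let f be the double exponential density with parameters η₁, η₂ > 0, p+q=1, p,q>0. Then the n-fold convolution f^{*(n)}(u) for u ≥ 0 has the form e^{-η₁u}·Σ_{k=1}^n P_{n,k}·η₁^k·u^{k-1}/(k-1)! for some nonnegative coefficients P_{n,k} with Σ_{k=1}^n P_{n,k} ≤ 1 (in particular P_{n,n} = p^n), i.e., the positive part of f^{*(n)} is a mixture of gamma densities with rate η₁ scaled by total mass at most 1. -/

import Mathlib

open Real MeasureTheory Finset

/-- Convolution of two functions on ℝ. -/
noncomputable def convR (f g : ℝ → ℝ) : ℝ → ℝ := fun u => ∫ v : ℝ, f (u - v) * g v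

/-- `iterConv f n` is the (n+1)-fold convolution f^{*(n+1)}. -/
noncomputable def iterConv (f : ℝ → ℝ) : ℕ → ℝ → ℝ
  | 0 => f
  | n + 1 => convR (iterConv f n) f

/-- The gamma density of shape `k + 1` and rate `a`, extended to all of `ℝ` by its formula. -/
noncomputable def gammaFun (a : ℝ) (k : ℕ) (t : ℝ) : ℝ :=
  a ^ (k + 1) * t ^ k / k.factorial * Real.exp (-a * t)

/-- The gamma part of the convolution of a gamma density of shape `k + 1` and rate `a` with a
reflected exponential density of rate `b`. -/
noncomputable def gammaTail (a b : ℝ) (k : ℕ) (t : ℝ) : ℝ :=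
  b / (a + b) * ∑ j ∈ range (k + 1), (a / (a + b)) ^ (k - j) * gammaFun a j t

lemma gammaFun_zero (a t : ℝ) : gammaFun a 0 t = a * Real.exp (-a * t) := by
  simp [gammaFun]

lemma gammaFun_nonneg {a t : ℝ} (ha : 0 ≤ a) (ht : 0 ≤ t) (k : ℕ) : 0 ≤ gammaFun a k t := by
  unfold gammaFun; positivity

lemma continuous_gammaFun (a : ℝ) (k : ℕ) : Continuous (gammaFun a k) := by
  unfold gammaFun; fun_prop

lemma hasDerivAt_gammaFun_zero (a t : ℝ) :
    HasDerivAt (gammaFun a 0) (-a * gammaFun a 0 t) t := by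
  have h : HasDerivAt (fun t : ℝ => a * Real.exp (-a * t)) (a * (Real.exp (-a * t) * (-a * 1))) t :=
    ((((hasDerivAt_id t).const_mul (-a))).exp).const_mul a
  rw [show gammaFun a 0 = fun t => a * Real.exp (-a * t) from funext (gammaFun_zero a)]
  exact h.congr_deriv (by ring)

lemma hasDerivAt_gammaFun_succ (a t : ℝ) (k : ℕ) :
    HasDerivAt (gammaFun a (k + 1)) (a * (gammaFun a k t - gammaFun a (k + 1) t)) t := by
  have h := ((((hasDerivAt_pow (k + 1) t).const_mul (a ^ (k + 1 + 1))).div_const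
    ((k + 1).factorial : ℝ))).mul (((hasDerivAt_id t).const_mul (-a)).exp)
  refine HasDerivAt.congr_deriv (f := gammaFun a (k + 1)) h ?_
  simp only [gammaFun, Nat.factorial_succ, id]
  push_cast
  have : (k.factorial : ℝ) ≠ 0 := by positivity
  have : (k : ℝ) + 1 ≠ 0 := by positivity
  field_simp
  ring

open Filter Topology in
lemma tendsto_gammaFun {a : ℝ} (ha : 0 < a) (k : ℕ) :
    Tendsto (gammaFun a k) atTop (𝓝 0) := by
  have h := ((Real.tendsto_pow_mul_exp_neg_atTop_nhds_zero k).comp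
    (tendsto_id.const_mul_atTop ha)).const_mul (a / k.factorial)
  rw [mul_zero] at h
  refine h.congr fun t => ?_
  simp only [gammaFun, Function.comp, id, mul_pow, neg_mul]
  ring

lemma gammaTail_zero (a b t : ℝ) : gammaTail a b 0 t = b / (a + b) * gammaFun a 0 t := by
  simp [gammaTail]

lemma gammaTail_succ (a b t : ℝ) (k : ℕ) :
    gammaTail a b (k + 1) t =
      b / (a + b) * gammaFun a (k + 1) t + a / (a + b) * gammaTail a b k t := by
  have h : ∑ j ∈ range (k + 1), (a / (a + b)) ^ (k + 1 - j) * gammaFun a j t =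
      a / (a + b) * ∑ j ∈ range (k + 1), (a / (a + b)) ^ (k - j) * gammaFun a j t := by
    rw [mul_sum]
    refine sum_congr rfl fun j hj => ?_
    rw [Nat.succ_sub (Nat.lt_succ_iff.mp (mem_range.mp hj)), pow_succ]
    ring
  rw [gammaTail, sum_range_succ, h, gammaTail]
  simp
  ring

lemma gammaTail_at_zero {a b : ℝ} (k : ℕ) :
    gammaTail a b k 0 = (a / (a + b)) ^ (k + 1) * b := by
  induction k with
  | zero => simp [gammaTail_zero, gammaFun_zero]; ring
  | succ k ih =>
    rw [gammaTail_succ, ih]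
    simp [gammaFun]
    ring

lemma hasDerivAt_gammaTail {a b : ℝ} (ha : 0 < a) (hb : 0 < b) (t : ℝ) (k : ℕ) :
    HasDerivAt (gammaTail a b k) (b * (gammaTail a b k t - gammaFun a k t)) t := by
  have hab : a + b ≠ 0 := by positivity
  induction k with
  | zero =>
    have h := (hasDerivAt_gammaFun_zero a t).const_mul (b / (a + b))
    rw [show gammaTail a b 0 = fun t => b / (a + b) * gammaFun a 0 t from
      funext (gammaTail_zero a b)]
    refine h.congr_deriv ?_
    field_simp
    ring
  | succ k ih =>
    have h := ((hasDerivAt_gammaFun_succ a t k).const_mul (b / (a + b))).add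
      (ih.const_mul (a / (a + b)))
    rw [show gammaTail a b (k + 1) = fun t =>
      b / (a + b) * gammaFun a (k + 1) t + a / (a + b) * gammaTail a b k t from
      funext fun t => gammaTail_succ a b t k]
    refine h.congr_deriv ?_
    field_simp
    ring

open Filter Topology in
lemma tendsto_gammaTail {a b : ℝ} (ha : 0 < a) (k : ℕ) :
    Tendsto (gammaTail a b k) atTop (𝓝 0) := by
  have h := (tendsto_finsetSum (range (k + 1)) fun j _ =>
    (tendsto_gammaFun ha j).const_mul ((a / (a + b)) ^ (k - j))).const_mul (b / (a + b))
  simp only [mul_zero, sum_const_zero] at h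
  exact h

open Filter Topology in
lemma gammaFun_mul_exp_Ioi {a b c s : ℝ} (ha : 0 < a) (hb : 0 < b) (hs : 0 ≤ c + s) (k : ℕ) :
    IntegrableOn (fun t => gammaFun a k (c + t) * (b * Real.exp (-b * t))) (Set.Ioi s) ∧
      ∫ t in Set.Ioi s, gammaFun a k (c + t) * (b * Real.exp (-b * t)) =
        Real.exp (-b * s) * gammaTail a b k (c + s) := by
  have hd : ∀ t ∈ Set.Ici s, HasDerivAt (fun t => -(Real.exp (-b * t) * gammaTail a b k (c + t)))
      (gammaFun a k (c + t) * (b * Real.exp (-b * t))) t := by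
    intro t _
    have h := ((((hasDerivAt_id t).const_mul (-b)).exp).mul
      ((hasDerivAt_gammaTail ha hb (c + t) k).comp_const_add c t)).neg
    refine h.congr_deriv ?_
    simp only [id]
    ring
  have hpos : ∀ t ∈ Set.Ioi s, 0 ≤ gammaFun a k (c + t) * (b * Real.exp (-b * t)) := by
    intro t ht
    have : s < t := ht
    exact mul_nonneg (gammaFun_nonneg ha.le (by linarith) k) (by positivity)
  have hlim : Tendsto (fun t => -(Real.exp (-b * t) * gammaTail a b k (c + t))) atTop (𝓝 0) := by
    have h1 : Tendsto (fun t => Real.exp (-b * t)) atTop (𝓝 0) :=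
      Real.tendsto_exp_atBot.comp (tendsto_id.const_mul_atTop_of_neg (neg_lt_zero.mpr hb))
    simpa using (h1.mul ((tendsto_gammaTail (b := b) ha k).comp
      (tendsto_atTop_add_const_left atTop c tendsto_id))).neg
  refine ⟨integrableOn_Ioi_deriv_of_nonneg' hd hpos hlim, ?_⟩
  rw [integral_Ioi_of_hasDerivAt_of_nonneg' hd hpos hlim]
  ring

lemma gammaFun_mul_exp_Iio {a b u : ℝ} (ha : 0 < a) (hb : 0 < b) (hu : 0 ≤ u) (k : ℕ) :
    IntegrableOn (fun v => gammaFun a k (u - v) * (b * Real.exp (b * v))) (Set.Iio 0) ∧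
      ∫ v in Set.Iio 0, gammaFun a k (u - v) * (b * Real.exp (b * v)) = gammaTail a b k u := by
  obtain ⟨h1, h2⟩ := gammaFun_mul_exp_Ioi (c := u) (s := 0) ha hb (by linarith) k
  constructor
  · have h : IntegrableOn (fun t => gammaFun a k (u + t) * (b * Real.exp (-b * t)))
        (Set.Ioi (-0)) := by simpa using h1
    simpa [sub_eq_add_neg] using h.comp_neg_Iio
  · rw [← integral_Iic_eq_integral_Iio]
    have h := integral_comp_neg_Ioi 0 (fun v => gammaFun a k (u - v) * (b * Real.exp (b * v)))
    simp only [neg_zero] at h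
    rw [← h]
    simpa using h2

lemma gammaFun_mul_exp_Ioo {a u : ℝ} (hu : 0 ≤ u) (k : ℕ) :
    IntegrableOn (fun v => gammaFun a k (u - v) * (a * Real.exp (-a * v))) (Set.Ioo 0 u) ∧
      ∫ v in Set.Ioo 0 u, gammaFun a k (u - v) * (a * Real.exp (-a * v)) =
        gammaFun a (k + 1) u := by
  constructor
  · have hc : Continuous (fun v => gammaFun a k (u - v) * (a * Real.exp (-a * v))) := by
      have := continuous_gammaFun a k
      fun_prop
    exact (hc.integrableOn_Icc (a := 0) (b := u)).mono_set Set.Ioo_subset_Icc_self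
  · rw [← integral_Ioc_eq_integral_Ioo, ← intervalIntegral.integral_of_le hu]
    have h : ∀ v, gammaFun a k (u - v) * (a * Real.exp (-a * v)) =
        (a ^ (k + 2) / k.factorial * Real.exp (-a * u)) * (u - v) ^ k := by
      intro v
      have he : Real.exp (-a * u) = Real.exp (-a * (u - v)) * Real.exp (-a * v) := by
        rw [← Real.exp_add]; ring_nf
      rw [he, gammaFun]
      ring
    simp_rw [h]
    rw [intervalIntegral.integral_const_mul,
      intervalIntegral.integral_comp_sub_left (fun x => x ^ k), integral_pow, gammaFun,
      Nat.factorial_succ]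
    push_cast
    have : (k.factorial : ℝ) ≠ 0 := by positivity
    have : (k : ℝ) + 1 ≠ 0 := by positivity
    field_simp
    simp

lemma convR_gamma_mixture {a b p q : ℝ} (ha : 0 < a) (hb : 0 < b) {g h : ℝ → ℝ} {m : ℕ}
    {P Q : ℕ → ℝ}
    (hg_pos : ∀ x, 0 < x → g x = ∑ k ∈ range m, P k * gammaFun a k x)
    (hg_neg : ∀ x, x < 0 → g x = ∑ k ∈ range m, Q k * gammaFun b k (-x))
    (hh_pos : ∀ x, 0 < x → h x = p * (a * Real.exp (-a * x)))
    (hh_neg : ∀ x, x < 0 → h x = q * (b * Real.exp (b * x))) {u : ℝ} (hu : 0 ≤ u) :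
    convR g h u = q * ∑ k ∈ range m, P k * gammaTail a b k u
      + p * ∑ k ∈ range m, P k * gammaFun a (k + 1) u
      + p * (∑ k ∈ range m, Q k * (b / (a + b)) ^ (k + 1)) * gammaFun a 0 u := by
  have hIio := gammaFun_mul_exp_Iio ha hb hu
  have hIoo := gammaFun_mul_exp_Ioo (a := a) hu
  have hIoi := gammaFun_mul_exp_Ioi (c := -u) (s := u) hb ha (by simp)
  set F₁ : ℝ → ℝ := fun v =>
    ∑ k ∈ range m, q * P k * (gammaFun a k (u - v) * (b * Real.exp (b * v))) with hF₁
  set F₂ : ℝ → ℝ := fun v =>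
    ∑ k ∈ range m, p * P k * (gammaFun a k (u - v) * (a * Real.exp (-a * v))) with hF₂
  set F₃ : ℝ → ℝ := fun v =>
    ∑ k ∈ range m, p * Q k * (gammaFun b k (-u + v) * (a * Real.exp (-a * v))) with hF₃
  have i₁ : IntegrableOn F₁ (Set.Iio 0) :=
    integrable_finsetSum _ fun k _ => (hIio k).1.const_mul _
  have i₂ : IntegrableOn F₂ (Set.Ioo 0 u) :=
    integrable_finsetSum _ fun k _ => (hIoo k).1.const_mul _
  have i₃ : IntegrableOn F₃ (Set.Ioi u) :=
    integrable_finsetSum _ fun k _ => (hIoi k).1.const_mul _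
  have hae : (fun v => g (u - v) * h v) =ᵐ[volume] fun v =>
      (Set.Iio 0).indicator F₁ v + (Set.Ioo 0 u).indicator F₂ v + (Set.Ioi u).indicator F₃ v := by
    filter_upwards [Measure.ae_ne volume (0 : ℝ), Measure.ae_ne volume u] with v hv0 hvu
    rcases lt_or_gt_of_ne hv0 with hv | hv
    · have h2 : v ∉ Set.Ioo 0 u := fun hm => absurd hm.1 hv.not_gt
      have h3 : v ∉ Set.Ioi u := fun hm => absurd (hv.trans_le hu) (not_lt.mpr (le_of_lt hm))
      rw [Set.indicator_of_mem (Set.mem_Iio.mpr hv), Set.indicator_of_notMem h2,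
        Set.indicator_of_notMem h3, hg_pos _ (by linarith), hh_neg _ hv, sum_mul, hF₁]
      simp only [add_zero]
      exact sum_congr rfl fun k _ => by ring
    · have h1 : v ∉ Set.Iio (0 : ℝ) := fun hm => absurd hm hv.not_gt
      rcases lt_or_gt_of_ne hvu with hv' | hv'
      · have h3 : v ∉ Set.Ioi u := fun hm => absurd hm hv'.not_gt
        rw [Set.indicator_of_notMem h1, Set.indicator_of_mem (Set.mem_Ioo.mpr ⟨hv, hv'⟩),
          Set.indicator_of_notMem h3, hg_pos _ (by linarith), hh_pos _ hv, sum_mul, hF₂]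
        simp only [add_zero, zero_add]
        exact sum_congr rfl fun k _ => by ring
      · have h2 : v ∉ Set.Ioo 0 u := fun hm => absurd hm.2 hv'.not_gt
        rw [Set.indicator_of_notMem h1, Set.indicator_of_notMem h2,
          Set.indicator_of_mem (Set.mem_Ioi.mpr hv'), hg_neg _ (by linarith), hh_pos _ hv,
          sum_mul, hF₃]
        simp only [zero_add, neg_sub, neg_add_eq_sub]
        exact sum_congr rfl fun k _ => by ring
  have j₁ := (integrable_indicator_iff measurableSet_Iio).mpr i₁
  have j₂ := (integrable_indicator_iff measurableSet_Ioo).mpr i₂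
  have j₃ := (integrable_indicator_iff measurableSet_Ioi).mpr i₃
  rw [convR, integral_congr_ae hae,
    integral_add (f := fun v => (Set.Iio 0).indicator F₁ v + (Set.Ioo 0 u).indicator F₂ v)
      (j₁.add j₂) j₃, integral_add j₁ j₂,
    integral_indicator measurableSet_Iio, integral_indicator measurableSet_Ioo,
    integral_indicator measurableSet_Ioi, hF₁, hF₂, hF₃,
    integral_finsetSum _ fun k _ => (hIio k).1.const_mul _,
    integral_finsetSum _ fun k _ => (hIoo k).1.const_mul _,
    integral_finsetSum _ fun k _ => (hIoi k).1.const_mul _]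
  simp_rw [integral_const_mul, fun k => (hIio k).2, fun k => (hIoo k).2, fun k => (hIoi k).2]
  simp only [neg_add_cancel, gammaTail_at_zero, gammaFun_zero, mul_sum, sum_mul, add_comm b a]
  congr 1
  · congr 1 <;> exact sum_congr rfl fun k _ => by ring
  · exact sum_congr rfl fun k _ => by ring

open Filter in
lemma convR_comp_neg (g h : ℝ → ℝ) (u : ℝ) :
    convR (fun x => g (-x)) (fun x => h (-x)) u = convR g h (-u) := by
  unfold convR
  rw [← integral_neg_eq_self]
  refine integral_congr_ae (Eventually.of_forall fun v => ?_)
  simp only [neg_neg]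
  congr 2
  ring

/-- The coefficients of the positive part after convolving a two-sided gamma mixture with
coefficients `P` and `Q` with a two-sided exponential density. -/
noncomputable def nextCoeff (a b p q : ℝ) (m : ℕ) (P Q : ℕ → ℝ) (j : ℕ) : ℝ :=
  q * ∑ k ∈ range m, (if j ≤ k then P k * (b / (a + b) * (a / (a + b)) ^ (k - j)) else 0)
    + p * (if j = 0 then ∑ k ∈ range m, Q k * (b / (a + b)) ^ (k + 1) else P (j - 1))

lemma nextCoeff_nonneg {a b p q : ℝ} (ha : 0 < a) (hb : 0 < b) (hp : 0 ≤ p) (hq : 0 ≤ q)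
    {m : ℕ} {P Q : ℕ → ℝ} (hP : ∀ k < m, 0 ≤ P k) (hQ : ∀ k < m, 0 ≤ Q k) {j : ℕ}
    (hj : j < m + 1) : 0 ≤ nextCoeff a b p q m P Q j := by
  refine add_nonneg (mul_nonneg hq (sum_nonneg fun k hk => ?_)) (mul_nonneg hp ?_)
  · have := hP k (mem_range.mp hk)
    split_ifs <;> positivity
  · split_ifs with h
    · refine sum_nonneg fun k hk => ?_
      have := hQ k (mem_range.mp hk)
      positivity
    · exact hP _ (by omega)

lemma nextCoeff_last (a b p q : ℝ) (m : ℕ) (P Q : ℕ → ℝ) :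
    nextCoeff a b p q (m + 1) P Q (m + 1) = p * P m := by
  rw [nextCoeff, sum_eq_zero fun k hk => if_neg (by have := mem_range.mp hk; omega)]
  simp

lemma sum_nextCoeff_mul (a b p q : ℝ) (m : ℕ) (P Q w : ℕ → ℝ) :
    ∑ j ∈ range (m + 1), nextCoeff a b p q m P Q j * w j =
      q * ∑ k ∈ range m, P k *
          (b / (a + b) * ∑ j ∈ range (k + 1), (a / (a + b)) ^ (k - j) * w j)
        + p * ∑ k ∈ range m, P k * w (k + 1)
        + p * (∑ k ∈ range m, Q k * (b / (a + b)) ^ (k + 1)) * w 0 := by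
  simp only [nextCoeff, add_mul, sum_add_distrib]
  rw [add_assoc]
  congr 1
  · simp only [mul_assoc, ← mul_sum, sum_mul]
    rw [sum_comm]
    congr 1
    refine sum_congr rfl fun k hk => ?_
    have hk := mem_range.mp hk
    have hsub : range (k + 1) ⊆ range (m + 1) := range_subset_range.mpr (by omega)
    rw [← sum_subset hsub fun j _ hj => by
      rw [if_neg (by simpa using hj), zero_mul], mul_sum, mul_sum]
    refine sum_congr rfl fun j hj => ?_
    rw [if_pos (by simpa [Nat.lt_succ_iff] using hj)]
    ring
  · rw [sum_range_succ']
    simp [mul_sum, mul_assoc]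

lemma sum_nextCoeff {a b p q : ℝ} (ha : 0 < a) (hb : 0 < b) (m : ℕ) (P Q : ℕ → ℝ) :
    ∑ j ∈ range (m + 1), nextCoeff a b p q m P Q j =
      (p + q) * ∑ k ∈ range m, P k - q * ∑ k ∈ range m, P k * (a / (a + b)) ^ (k + 1)
        + p * ∑ k ∈ range m, Q k * (b / (a + b)) ^ (k + 1) := by
  have hgeom : ∀ k : ℕ, b / (a + b) * ∑ j ∈ range (k + 1), (a / (a + b)) ^ (k - j) =
      1 - (a / (a + b)) ^ (k + 1) := by
    intro k
    have h := sum_range_reflect (fun i => (a / (a + b)) ^ i) (k + 1)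
    simp only [Nat.add_sub_cancel] at h
    have hb' : b / (a + b) = 1 - a / (a + b) := by
      have : a + b ≠ 0 := by positivity
      field_simp
      ring
    rw [h, hb', mul_neg_geom_sum]
  have h := sum_nextCoeff_mul a b p q m P Q fun _ => 1
  simp only [mul_one, hgeom] at h
  rw [h]
  simp only [mul_sub, sum_sub_distrib, mul_one]
  ring

theorem iterConv_two_sided_gamma_mixture {a b p q : ℝ} (ha : 0 < a) (hb : 0 < b) (hp : 0 < p)
    (hq : 0 < q) (hpq : p + q = 1) {f : ℝ → ℝ}
    (hf : ∀ u : ℝ, f u = if 0 ≤ u then p * a * Real.exp (-a * u) else q * b * Real.exp (b * u))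
    (n : ℕ) :
    ∃ P Q : ℕ → ℝ, (∀ k < n + 1, 0 ≤ P k) ∧ (∀ k < n + 1, 0 ≤ Q k) ∧
      ∑ k ∈ range (n + 1), P k + ∑ k ∈ range (n + 1), Q k = 1 ∧ P n = p ^ (n + 1) ∧
      (∀ u, 0 ≤ u → iterConv f n u = ∑ k ∈ range (n + 1), P k * gammaFun a k u) ∧
      ∀ u, u < 0 → iterConv f n u = ∑ k ∈ range (n + 1), Q k * gammaFun b k (-u) := by
  have hf_pos : ∀ x, 0 ≤ x → f x = p * (a * Real.exp (-a * x)) := fun x hx => by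
    rw [hf, if_pos hx, mul_assoc]
  have hf_neg : ∀ x, x < 0 → f x = q * (b * Real.exp (b * x)) := fun x hx => by
    rw [hf, if_neg hx.not_ge, mul_assoc]
  induction n with
  | zero =>
    refine ⟨fun _ => p, fun _ => q, fun _ _ => hp.le, fun _ _ => hq.le, by simpa using hpq,
      by simp, fun u hu => ?_, fun u hu => ?_⟩
    · simp [iterConv, hf_pos u hu, gammaFun_zero]
    · simp [iterConv, hf_neg u hu, gammaFun_zero]
  | succ n ih =>
    obtain ⟨P, Q, hP, hQ, hsum, hlast, hpos, hneg⟩ := ih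
    refine ⟨nextCoeff a b p q (n + 1) P Q, nextCoeff b a q p (n + 1) Q P,
      fun k hk => nextCoeff_nonneg ha hb hp.le hq.le hP hQ hk,
      fun k hk => nextCoeff_nonneg hb ha hq.le hp.le hQ hP hk, ?_, ?_, fun u hu => ?_,
      fun u hu => ?_⟩
    · rw [sum_nextCoeff ha hb, sum_nextCoeff hb ha, add_comm q p, hpq, add_comm b a]
      linarith
    · rw [nextCoeff_last, hlast, pow_succ' p (n + 1)]
    · rw [iterConv, convR_gamma_mixture ha hb (fun x hx => hpos x hx.le) hneg
        (fun x hx => hf_pos x hx.le) hf_neg hu, sum_nextCoeff_mul]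
      rfl
    · have h := convR_comp_neg (iterConv f n) f (-u)
      rw [neg_neg] at h
      rw [iterConv, ← h, convR_gamma_mixture (a := b) (b := a) (p := q) (q := p) (P := Q) (Q := P)
        (m := n + 1) hb ha (fun x hx => by rw [hneg _ (by linarith), neg_neg])
        (fun x hx => hpos _ (by linarith))
        (fun x hx => by rw [hf_neg _ (by linarith), mul_neg, neg_mul])
        (fun x hx => by rw [hf_pos _ (by linarith), neg_mul_neg]) (by linarith),
        sum_nextCoeff_mul]
      rfl

/-- The positive part of the n-fold convolution of the double exponential density
is a mixture of gamma densities with rate η₁, with nonnegative coefficients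
P_{n,k} summing to at most 1 and P_{n,n} = p^n. -/
theorem double_exponential_nfold_convolution_positive_part
    (η₁ η₂ p q : ℝ) (hη₁ : 0 < η₁) (hη₂ : 0 < η₂) (hp : 0 < p) (hq : 0 < q)
    (hpq : p + q = 1)
    (f : ℝ → ℝ)
    (hf : ∀ u : ℝ, f u = if 0 ≤ u then p * η₁ * Real.exp (-η₁ * u)
        else q * η₂ * Real.exp (η₂ * u)) :
    ∀ n : ℕ, ∃ P : ℕ → ℝ,
      (∀ k ∈ Finset.Icc 1 (n + 1), 0 ≤ P k) ∧
      (∑ k ∈ Finset.Icc 1 (n + 1), P k) ≤ 1 ∧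
      P (n + 1) = p ^ (n + 1) ∧
      ∀ u : ℝ, 0 ≤ u →
        iterConv f n u =
          Real.exp (-η₁ * u) *
            ∑ k ∈ Finset.Icc 1 (n + 1),
              P k * η₁ ^ k * u ^ (k - 1) / (k - 1).factorial := by
  intro n
  obtain ⟨P, Q, hP, hQ, hsum, hlast, hpos, -⟩ :=
    iterConv_two_sided_gamma_mixture hη₁ hη₂ hp hq hpq hf n
  have hIcc : ∀ w : ℕ → ℝ, ∑ k ∈ Finset.Icc 1 (n + 1), w k = ∑ k ∈ range (n + 1), w (k + 1) := by
    intro w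
    rw [← Finset.Ico_add_one_right_eq_Icc, sum_Ico_eq_sum_range]
    simp [add_comm]
  refine ⟨fun k => P (k - 1), fun k hk => hP _ ?_, ?_, by simpa using hlast, fun u hu => ?_⟩
  · have := Finset.mem_Icc.mp hk
    omega
  · have hQ_sum : 0 ≤ ∑ k ∈ range (n + 1), Q k :=
      sum_nonneg fun k hk => hQ k (mem_range.mp hk)
    rw [hIcc]
    simp only [Nat.add_sub_cancel]
    linarith
  · rw [hpos u hu, hIcc, mul_sum]
    refine sum_congr rfl fun k _ => ?_
    simp only [gammaFun, Nat.add_sub_cancel]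
    ring
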